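/- There exists C > 0 such that for every φ ∈ 𝒪¹(ℂ̄∖[0,1]) that is bounded on ℂ∖[0,1] and every integer k ≥ 0: sup_{z∈ℂ∖[0,1]} |(T^k φ)(z)| ≤ C·(1 + k)·((√5 − 1)/2)^k · sup_{z∈ℂ∖[0,1]} |φ(z)|. In particular, T restricts to a bounded operator on the space of bounded functions in 𝒪¹(ℂ̄∖[0,1]) equipped with the sup norm, with spectral radius at most (√5 − 1)/2. -/

import Mathlib

open Complex Filter Set Topology
open scoped ENNReal NNReal

noncomputable section

/-- The complement in `ℂ` of the real segment `[a, b]`. -/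
def cutPlane (a b : ℝ) : Set ℂ := (Complex.ofReal '' Set.Icc a b)ᶜ

/-- `𝒪¹(ℂ̄ ∖ [a,b])`: holomorphic on `ℂ ∖ [a,b]`, vanishing at infinity. -/
def O1 (a b : ℝ) : Set (ℂ → ℂ) :=
  {φ | DifferentiableOn ℂ φ (cutPlane a b) ∧
       Tendsto φ (Bornology.cobounded ℂ) (nhds 0)}

/-- `𝒪³(ℂ̄ ∖ [a,b])`: holomorphic on `ℂ ∖ [a,b]`, with `z²ψ(z) → 0` at infinity. -/
def O3 (a b : ℝ) : Set (ℂ → ℂ) :=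
  {ψ | DifferentiableOn ℂ ψ (cutPlane a b) ∧
       Tendsto (fun z => z ^ 2 * ψ z) (Bornology.cobounded ℂ) (nhds 0)}

/-- The `m`-th term (for the integer `m+1 ≥ 1`) of the series defining `T`. -/
def Tterm (φ : ℂ → ℂ) (m : ℕ) (z : ℂ) : ℂ :=
  -z * (φ (z⁻¹ - ((m : ℂ) + 1)) - φ (-((m : ℂ) + 1))) + deriv φ (-((m : ℂ) + 1))

/-- The operator `T`. -/
def Tbrj (φ : ℂ → ℂ) : ℂ → ℂ := fun z => ∑' m : ℕ, Tterm φ m z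

/-- The operator `T⁽³⁾`. -/
def T3brj (ψ : ℂ → ℂ) : ℂ → ℂ := fun z => -∑' m : ℕ, (z⁻¹) ^ 3 * ψ (z⁻¹ - ((m : ℂ) + 1))

/-- `g(m) = (0 1; 1 m)`. -/
def gmat (m : ℤ) : Matrix (Fin 2) (Fin 2) ℤ := !![0, 1; 1, m]

/-- The monoid `ℳ`. -/
def Mmon : Set (Matrix (Fin 2) (Fin 2) ℤ) :=
  {g | g = 1 ∨
    ((g 0 0 * g 1 1 - g 0 1 * g 1 0 = 1 ∨ g 0 0 * g 1 1 - g 0 1 * g 1 0 = -1) ∧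
      g 0 1 ≤ g 1 1 ∧ g 0 0 ≤ g 0 1 ∧ 0 ≤ g 0 0 ∧ g 1 0 ≤ g 1 1 ∧ g 0 0 ≤ g 1 0)}

/-- The operator `L_g` on `𝒪¹(ℂ̄ ∖ [0,1])`, for `g = (a b; c d) ∈ ℳ`. -/
def Lop (g : Matrix (Fin 2) (Fin 2) ℤ) (φ : ℂ → ℂ) : ℂ → ℂ := fun z =>
  if g = 1 then φ z
  else
    ((g 0 0 : ℂ) - (g 1 0 : ℂ) * z) *
        (φ (((g 1 1 : ℂ) * z - (g 0 1 : ℂ)) / ((g 0 0 : ℂ) - (g 1 0 : ℂ) * z)) -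
          φ (-(g 1 1 : ℂ) / (g 1 0 : ℂ))) -
      ((g 0 0 * g 1 1 - g 0 1 * g 1 0 : ℤ) : ℂ) * ((g 1 0 : ℂ))⁻¹ *
        deriv φ (-(g 1 1 : ℂ) / (g 1 0 : ℂ))

/-- `Σ_ℳ φ`, the sum of the family `(L_g φ)_{g ∈ ℳ}`. -/
def sumM (φ : ℂ → ℂ) : ℂ → ℂ := fun z => ∑' g : Mmon, Lop g.1 φ z

/-- The domain `D`. -/
def Dset : Set ℂ :=
  {z | ‖z‖ ≤ 1 ∧ 1 ≤ ‖z - Complex.I‖ ∧ 1 ≤ ‖z + Complex.I‖ ∧ 0 < z.re}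

/-- The domain `D₀`. -/
def D0set : Set ℂ := {z | ‖z + 1‖ ≤ 1 ∧ Real.sqrt 3 / 2 - 1 ≤ z.re}

/-- The domain `D₁`. -/
def D1set : Set ℂ :=
  {z | 1 ≤ ‖z‖ ∧ ‖z - (1 / Real.sqrt 3 : ℝ)‖ ≤ 1 / Real.sqrt 3}

/-- The domain `H₀`. -/
def H0set : Set ℂ := {z | ‖z - Complex.I‖ ≤ 1 ∧ 1 ≤ ‖z + 1‖ ∧ z.im ≤ 1 / 2}

/-- The domain `H₀′`. -/
def H0set' : Set ℂ := {z | (starRingEnd ℂ) z ∈ H0set}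

/-- The domain `Δ`. -/
def Δset : Set ℂ := {z | ‖z‖ ≤ 1 ∧ 1 ≤ ‖z + 1‖ ∧ |z.im| ≤ 1 / 2}

/-- The domain `D∞`. -/
def Dinf : Set ℂ :=
  {z | 1 / 2 < |z.im|} ∪ {z | z.re < Real.sqrt 3 / 2 - 1} ∪
    {z | Real.sqrt 3 / 2 < z.re ∧ 1 / Real.sqrt 3 < ‖z - (1 / Real.sqrt 3 : ℝ)‖}

end

section RealEstimates

/-- An odd increasing function on `ℝ`, concave on `[0, ∞)`, with density `s / (2 √u (s + √u))`. -/
noncomputable def potential (s u : ℝ) : ℝ := s * (Real.log (1 + √u / s) - Real.log (1 + √(-u) / s))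

lemma potential_neg (s u : ℝ) : potential s (-u) = -potential s u := by
  simp only [potential, neg_neg]; ring

lemma potential_mono {s : ℝ} (hs : 0 < s) : Monotone (potential s) := by
  intro u v huv
  have h₁ : Real.log (1 + √u / s) ≤ Real.log (1 + √v / s) := by gcongr
  have h₂ : Real.log (1 + √(-v) / s) ≤ Real.log (1 + √(-u) / s) := by gcongr
  exact mul_le_mul_of_nonneg_left (by linarith) hs.le

lemma monotone_potential_sub {s : ℝ} (hs : 0 < s) (x : ℝ) :
    Monotone fun t => potential s (t - x) :=
  fun _ _ h => potential_mono hs (sub_le_sub_right h x)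

lemma potential_sub_ge_of_abs_le {s u v : ℝ} (hs : 0 < s) (hv : 0 < v) (huv : |u| ≤ v) :
    s * (v - u) / (2 * √v * (s + √v)) ≤ potential s v - potential s u := by
  obtain ⟨hu₁, hu₂⟩ := abs_le.1 huv
  set r := √v with hr
  have hr0 : 0 < r := Real.sqrt_pos.2 hv
  have hrv : v = r ^ 2 := (Real.sq_sqrt hv.le).symm
  have hvneg : √(-v) = 0 := Real.sqrt_eq_zero_of_nonpos (by linarith)
  have key : s * (r - √u) / (s + r) ≤ s * (Real.log (1 + r / s) - Real.log (1 + √u / s)) := by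
    have hp : 0 ≤ √u := Real.sqrt_nonneg u
    have h1 : 0 < 1 + √u / s := by positivity
    have h2 : 0 < 1 + r / s := by positivity
    have h := Real.one_sub_inv_le_log_of_pos (div_pos h2 h1)
    rw [Real.log_div h2.ne' h1.ne'] at h
    have e : 1 - ((1 + r / s) / (1 + √u / s))⁻¹ = (r - √u) / (s + r) := by
      field_simp
      ring
    rw [e] at h
    rw [mul_div_assoc]
    exact mul_le_mul_of_nonneg_left h hs.le
  have hlog : 0 ≤ Real.log (1 + √(-u) / s) :=
    Real.log_nonneg (by have : 0 ≤ √(-u) / s := by positivity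
                        linarith)
  have step : s * (v - u) / (2 * r * (s + r)) ≤ s * (r - √u) / (s + r) := by
    have : v - u ≤ 2 * r * (r - √u) := by
      rcases le_total 0 u with h | h
      · have h3 : u = √u ^ 2 := (Real.sq_sqrt h).symm
        nlinarith [sq_nonneg (r - √u)]
      · rw [Real.sqrt_eq_zero_of_nonpos h]; nlinarith
    rw [div_le_div_iff₀ (by positivity) (by positivity)]
    have h4 : 0 < s * (s + r) := by positivity
    nlinarith [mul_le_mul_of_nonneg_left this h4.le]
  have e2 : potential s v - potential s u =
      s * (Real.log (1 + r / s) - Real.log (1 + √u / s)) + s * Real.log (1 + √(-u) / s) := by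
    simp only [potential, hvneg, ← hr]; simp; ring
  rw [e2]
  have := mul_nonneg hs.le hlog
  linarith

lemma potential_sub_ge {s σ u v V : ℝ} (hσ : 0 < σ) (hσs : σ ≤ s) (huv : u ≤ v)
    (hu : |u| ≤ V) (hv : |v| ≤ V) :
    σ * (v - u) / (V + σ ^ 2) ≤ 3 * (potential s v - potential s u) := by
  have hs : 0 < s := hσ.trans_le hσs
  rcases huv.eq_or_lt with rfl | hlt
  · simp
  wlog h : |u| ≤ v generalizing u v
  · have h' : |(-v)| ≤ -u := by
      rw [abs_neg]
      rcases abs_cases u with ⟨h1, _⟩ | ⟨h1, _⟩ <;> rcases abs_cases v with ⟨h2, _⟩ | ⟨h2, _⟩ <;>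
        rw [h1] at h <;> linarith
    have := this (u := -v) (v := -u) (by linarith) (by rwa [abs_neg]) (by rwa [abs_neg])
      (by linarith) h'
    rw [potential_neg, potential_neg] at this
    convert this using 2 <;> ring
  have hv0 : 0 < v := by
    by_contra hc
    have := (abs_nonneg u).trans h
    have h0 : v = 0 := by linarith
    subst h0
    have := abs_nonpos_iff.1 h
    linarith
  have hvV : v ≤ V := (le_abs_self v).trans hv
  have h1 := potential_sub_ge_of_abs_le hs hv0 h
  suffices hh : σ * (v - u) / (V + σ ^ 2) ≤ 3 * (s * (v - u) / (2 * √v * (s + √v))) by linarith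
  have hr0 : 0 < √v := Real.sqrt_pos.2 hv0
  have hrv : √v ^ 2 = v := Real.sq_sqrt hv0.le
  set r := √v
  have hd : 0 < v - u := by linarith
  have hV : 0 < V := hv0.trans_le hvV
  have h2 : σ / (V + σ ^ 2) ≤ 3 * s / (2 * r * (s + r)) := by
    rw [div_le_div_iff₀ (by positivity) (by positivity)]
    nlinarith [mul_nonneg hs.le (sq_nonneg (r - σ)), mul_nonneg hs.le (sub_nonneg.2 hvV),
      mul_nonneg (sub_nonneg.2 hσs) (sq_nonneg r)]
  calc σ * (v - u) / (V + σ ^ 2) = σ / (V + σ ^ 2) * (v - u) := by ring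
    _ ≤ 3 * s / (2 * r * (s + r)) * (v - u) := by gcongr
    _ = _ := by ring

lemma potential_le {s u : ℝ} (hs : 0 < s) (hu : u ≤ 1) :
    potential s u ≤ s * Real.log (1 + 1 / s) := by
  refine mul_le_mul_of_nonneg_left ?_ hs.le
  have h1 : 0 ≤ Real.log (1 + √(-u) / s) :=
    Real.log_nonneg (by have : 0 ≤ √(-u) / s := by positivity
                        linarith)
  have h2 : Real.log (1 + √u / s) ≤ Real.log (1 + 1 / s) := by
    have : √u ≤ 1 := Real.sqrt_le_one.2 hu
    gcongr
  linarith

/-- Sums of increments of a monotone function along a sequence of Möbius images telescope. -/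
lemma sum_abs_sub_le {f : ℝ → ℝ} (hf : Monotone f) {a b c d : ℝ} (hc : 0 ≤ c) (hd : 0 < d) (N : ℕ) :
    ∑ m ∈ Finset.range N, |f ((b + (a + b * (m + 1))) / (d + (c + d * (m + 1)))) -
      f ((a + b * (m + 1)) / (c + d * (m + 1)))| ≤ |f ((a + b) / (c + d)) - f (b / d)| := by
  set t : ℕ → ℝ := fun m => (a + b * (m + 1)) / (c + d * (m + 1)) with ht
  have hpos : ∀ m : ℕ, 0 < c + d * (m + 1) := fun m => by positivity
  have e0 : (a + b) / (c + d) = t 0 := by simp [ht]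
  have e1 : ∀ m : ℕ, (b + (a + b * (m + 1))) / (d + (c + d * (m + 1))) = t (m + 1) := by
    intro m; simp only [ht]; push_cast; congr 1 <;> ring
  have ediff : ∀ m : ℕ, t m = b / d + (a * d - b * c) / d / (c + d * (m + 1)) := by
    intro m
    have := (hpos m).ne'
    simp only [ht]; field_simp; ring
  have hinv : ∀ m : ℕ, 1 / (c + d * ((m + 1 : ℕ) + 1)) ≤ 1 / (c + d * (m + 1)) := by
    intro m
    have := hpos m
    push_cast
    gcongr
    linarith
  rw [e0]
  simp only [e1]
  change ∑ m ∈ Finset.range N, |f (t (m + 1)) - f (t m)| ≤ _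
  rcases le_total 0 (a * d - b * c) with h | h
  · have hanti : ∀ m, t (m + 1) ≤ t m := by
      intro m
      rw [ediff, ediff, div_eq_mul_one_div _ (c + _), div_eq_mul_one_div _ (c + d * ((m : ℝ) + 1))]
      have := mul_le_mul_of_nonneg_left (hinv m) (div_nonneg h hd.le)
      linarith
    have hlow : b / d ≤ t N := by
      rw [ediff]
      have := div_nonneg (div_nonneg h hd.le) (hpos N).le
      linarith
    have h1 : ∀ m ∈ Finset.range N, |f (t (m + 1)) - f (t m)| = -f (t (m + 1)) - -f (t m) := by
      intro m _
      rw [abs_of_nonpos (by linarith [hf (hanti m)])]; ring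
    rw [Finset.sum_congr rfl h1, Finset.sum_range_sub (fun m => -f (t m))]
    refine le_trans ?_ (le_abs_self _)
    linarith [hf hlow]
  · have hmono : ∀ m, t m ≤ t (m + 1) := by
      intro m
      rw [ediff, ediff, div_eq_mul_one_div _ (c + _), div_eq_mul_one_div _ (c + d * ((m + 1 : ℕ) + 1))]
      have := mul_le_mul_of_nonpos_left (hinv m) (div_nonpos_of_nonpos_of_nonneg h hd.le)
      linarith
    have hup : t N ≤ b / d := by
      rw [ediff]
      have := div_nonpos_of_nonpos_of_nonneg (div_nonpos_of_nonpos_of_nonneg h hd.le) (hpos N).le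
      linarith
    have h1 : ∀ m ∈ Finset.range N, |f (t (m + 1)) - f (t m)| = f (t (m + 1)) - f (t m) := by
      intro m _
      rw [abs_of_nonneg (by linarith [hf (hmono m)])]
    rw [Finset.sum_congr rfl h1, Finset.sum_range_sub (fun m => f (t m)), abs_sub_comm]
    refine le_trans ?_ (le_abs_self _)
    linarith [hf hup]

end RealEstimates

section CutPlane

lemma mem_cutPlane_iff {z : ℂ} :
    z ∈ cutPlane 0 1 ↔ ∀ t : ℝ, 0 ≤ t → t ≤ 1 → z ≠ t := by
  constructor
  · rintro h t h0 h1 rfl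
    exact h ⟨t, ⟨h0, h1⟩, rfl⟩
  · rintro h ⟨t, ⟨h0, h1⟩, rfl⟩
    exact h t h0 h1 rfl

lemma isOpen_cutPlane : IsOpen (cutPlane 0 1) :=
  ((isCompact_Icc.image Complex.continuous_ofReal).isClosed).isOpen_compl

lemma ne_zero_of_mem_cutPlane {z : ℂ} (hz : z ∈ cutPlane 0 1) : z ≠ 0 := by
  simpa using mem_cutPlane_iff.1 hz 0 le_rfl zero_le_one

lemma mem_cutPlane_of_re_neg {z : ℂ} (hz : z.re < 0) : z ∈ cutPlane 0 1 := by
  rw [mem_cutPlane_iff]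
  rintro t h0 - rfl
  simp at hz
  linarith

lemma mem_cutPlane_of_one_lt_norm {z : ℂ} (hz : 1 < ‖z‖) : z ∈ cutPlane 0 1 := by
  rw [mem_cutPlane_iff]
  rintro t h0 h1 rfl
  rw [Complex.norm_real, Real.norm_of_nonneg h0] at hz
  linarith

/-- Schwarz lemma at infinity for bounded functions in `𝒪¹(ℂ̄ ∖ [0,1])`. -/
lemma norm_mul_norm_le {φ : ℂ → ℂ} (hφ : φ ∈ O1 0 1) {M : ℝ}
    (hM : ∀ z ∈ cutPlane 0 1, ‖φ z‖ ≤ M) {w : ℂ} (hw : w ∈ cutPlane 0 1) : ‖φ w‖ * ‖w‖ ≤ M := by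
  rcases le_or_gt ‖w‖ 1 with h1 | h1
  · exact (mul_le_of_le_one_right (norm_nonneg _) h1).trans (hM w hw)
  have hM0 : 0 ≤ M := (norm_nonneg _).trans (hM w hw)
  set f : ℂ → ℂ := Function.update (fun u => φ u⁻¹) 0 0 with hf
  have hf0 : f 0 = 0 := by simp [hf]
  have hfne : ∀ u, u ≠ 0 → f u = φ u⁻¹ := fun u hu => by simp [hf, hu]
  have hinv : ∀ u ∈ Metric.ball (0 : ℂ) 1, u ≠ 0 → u⁻¹ ∈ cutPlane 0 1 := by
    intro u hu hu0
    apply mem_cutPlane_of_one_lt_norm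
    rw [norm_inv]
    exact (one_lt_inv₀ (norm_pos_iff.2 hu0)).2 (by simpa using hu)
  have hdiff : DifferentiableOn ℂ f (Metric.ball 0 1) := by
    rw [← Complex.differentiableOn_compl_singleton_and_continuousAt_iff
      (Metric.ball_mem_nhds (0 : ℂ) one_pos)]
    constructor
    · refine DifferentiableOn.congr (f := fun u => φ u⁻¹) ?_ fun u hu => hfne u hu.2
      refine hφ.1.comp ?_ fun u hu => hinv u hu.1 hu.2
      exact differentiableOn_inv.mono fun u hu => hu.2
    · rw [hf, continuousAt_update_same]
      exact hφ.2.comp Filter.tendsto_inv₀_nhdsNE_zero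
  have hmaps : MapsTo f (Metric.ball 0 1) (Metric.closedBall (f 0) M) := by
    intro u hu
    rw [hf0, mem_closedBall_zero_iff]
    by_cases h : u = 0
    · rwa [h, hf0, norm_zero]
    · rw [hfne u h]
      exact hM _ (hinv u hu h)
  have hw0 : w ≠ 0 := ne_zero_of_mem_cutPlane hw
  have hwb : w⁻¹ ∈ Metric.ball (0 : ℂ) 1 := by
    rw [mem_ball_zero_iff, norm_inv]
    exact inv_lt_one_of_one_lt₀ h1
  have := Complex.dist_le_div_mul_dist_of_mapsTo_ball hdiff hmaps hwb
  rw [hf0, dist_zero_right, dist_zero_right, hfne _ (inv_ne_zero hw0), inv_inv, norm_inv,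
    div_one] at this
  rwa [← div_eq_mul_inv, le_div_iff₀ (by linarith)] at this

lemma two_mul_norm_ge_of_mem_closedBall {y : ℝ} (hy : 1 ≤ y) {w : ℂ}
    (hw : w ∈ Metric.closedBall (-y : ℂ) (y / 2)) : w.re < 0 ∧ y ≤ 2 * ‖w‖ := by
  rw [mem_closedBall_iff_norm, sub_neg_eq_add] at hw
  have h1 := (Complex.abs_re_le_norm _).trans hw
  simp only [Complex.add_re, Complex.ofReal_re] at h1
  have h2 := Complex.abs_re_le_norm w
  rw [abs_le] at h1
  have h3 : w.re < 0 := by linarith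
  refine ⟨h3, ?_⟩
  rw [abs_of_neg h3] at h2
  linarith

lemma norm_deriv_le {φ : ℂ → ℂ} (hφ : φ ∈ O1 0 1) {M : ℝ}
    (hM : ∀ z ∈ cutPlane 0 1, ‖φ z‖ ≤ M) {y : ℝ} (hy : 1 ≤ y) :
    ‖deriv φ (-y)‖ ≤ 4 * M / y ^ 2 := by
  have hy0 : 0 < y := by linarith
  have hball := fun w hw => two_mul_norm_ge_of_mem_closedBall hy (w := w) hw
  have h := Complex.norm_deriv_le_of_forall_mem_sphere_norm_le (c := (-y : ℂ)) (R := y / 2)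
    (C := 2 * M / y) (f := φ) (by positivity) ?_ ?_
  · refine h.trans_eq ?_
    field_simp
    ring
  · refine DifferentiableOn.diffContOnCl ?_
    refine hφ.1.mono fun w hw => ?_
    rw [closure_ball _ (by positivity)] at hw
    exact mem_cutPlane_of_re_neg (hball w hw).1
  · intro w hw
    obtain ⟨h1, h2⟩ := hball w (Metric.sphere_subset_closedBall hw)
    have h3 := norm_mul_norm_le hφ hM (mem_cutPlane_of_re_neg h1)
    rw [le_div_iff₀ hy0]
    nlinarith [norm_nonneg (φ w)]

lemma norm_taylor_le {φ : ℂ → ℂ} (hφ : φ ∈ O1 0 1) {M : ℝ}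
    (hM : ∀ z ∈ cutPlane 0 1, ‖φ z‖ ≤ M) {y : ℝ} (hy : 1 ≤ y) {w : ℂ} (hw : ‖w + y‖ < y / 2) :
    ‖φ w - φ (-y) - (w + y) * deriv φ (-y)‖ ≤ 20 * M * ‖w + y‖ ^ 2 / y ^ 3 := by
  have hy0 : 0 < y := by linarith
  have hball := fun w hw => two_mul_norm_ge_of_mem_closedBall hy (w := w) hw
  have hcut : Metric.closedBall (-y : ℂ) (y / 2) ⊆ cutPlane 0 1 := fun w hw =>
    mem_cutPlane_of_re_neg (hball w hw).1
  set G : ℂ → ℂ := fun w => φ w - φ (-y) - (w + y) * deriv φ (-y) with hG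
  have hG0 : G (-y) = 0 := by simp [hG]
  have hcent : (-y : ℂ) ∈ cutPlane 0 1 := hcut (Metric.mem_closedBall_self (by positivity))
  have hdy : HasDerivAt φ (deriv φ (-y)) (-y : ℂ) :=
    ((hφ.1 _ hcent).differentiableAt (isOpen_cutPlane.mem_nhds hcent)).hasDerivAt
  have hD := norm_deriv_le hφ hM hy
  have hdiff : DifferentiableOn ℂ G (Metric.ball (-y : ℂ) (y / 2)) := by
    have := hφ.1.mono (Metric.ball_subset_closedBall.trans hcut)
    simp only [hG]
    fun_prop
  have hmaps : MapsTo G (Metric.ball (-y : ℂ) (y / 2)) (Metric.closedBall (G (-y)) (5 * M / y)) := by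
    intro w hw
    have hwc := Metric.ball_subset_closedBall hw
    obtain ⟨h1, h2⟩ := hball w hwc
    have h3 := norm_mul_norm_le hφ hM (hcut hwc)
    have h4 := norm_mul_norm_le hφ hM hcent
    rw [norm_neg, Complex.norm_real, Real.norm_of_nonneg hy0.le] at h4
    rw [mem_ball_iff_norm, sub_neg_eq_add] at hw
    rw [hG0, mem_closedBall_zero_iff]
    have h5 : ‖φ w‖ ≤ 2 * M / y := by
      rw [le_div_iff₀ hy0]; nlinarith [norm_nonneg (φ w)]
    have h6 : ‖φ (-y)‖ ≤ M / y := by rwa [le_div_iff₀ hy0]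
    have h7 : ‖(w + y) * deriv φ (-y)‖ ≤ y / 2 * (4 * M / y ^ 2) := by
      rw [norm_mul]; gcongr
    have h8 : y / 2 * (4 * M / y ^ 2) = 2 * M / y := by field_simp; norm_num
    have h9 : 5 * M / y = 2 * M / y + M / y + 2 * M / y := by ring
    calc ‖G w‖ ≤ ‖φ w‖ + ‖φ (-y)‖ + ‖(w + y) * deriv φ (-y)‖ :=
          (norm_sub_le _ _).trans (by gcongr; exact norm_sub_le _ _)
      _ ≤ _ := by linarith
  have hlit : (G · - G (-y)) =o[𝓝 (-y : ℂ)] fun w => ‖w - (-y)‖ ^ 1 := by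
    simp only [pow_one]
    refine Asymptotics.IsLittleO.norm_right ?_
    refine hdy.isLittleO.congr_left fun w => ?_
    rw [hG0]
    simp [hG]
  have hwb : w ∈ Metric.ball (-y : ℂ) (y / 2) := by
    rwa [mem_ball_iff_norm, sub_neg_eq_add]
  have := Complex.dist_le_mul_div_pow_of_mapsTo_ball_of_isLittleO hdiff hmaps hlit hwb
  rw [hG0, dist_zero_right, dist_eq_norm, sub_neg_eq_add] at this
  refine this.trans_eq ?_
  rw [one_add_one_eq_two, div_pow, div_pow]
  field_simp
  ring

end CutPlane

section Branches

/-- Nonidentity elements of the monoid `ℳ`, with real entries. -/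
structure IsBranch (a b c d : ℝ) : Prop where
  nonneg_left : 0 ≤ a
  nonneg_right : 0 ≤ b
  left_le : a ≤ c
  right_le : b ≤ d
  one_le : 1 ≤ c
  le : c ≤ d
  det : a * d - b * c = 1 ∨ a * d - b * c = -1

/-- The operator `L_g` for `g = (a b; c d)` with real entries and `c ≠ 0`. -/
noncomputable def branchOp (a b c d : ℝ) (φ : ℂ → ℂ) (z : ℂ) : ℂ :=
  (a - c * z) * (φ ((d * z - b) / (a - c * z)) - φ (-(d / c : ℝ))) -
    (a * d - b * c) / c * deriv φ (-(d / c : ℝ))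

namespace IsBranch

variable {a b c d : ℝ}

lemma gauss (m : ℕ) : IsBranch 0 1 1 (m + 1) := by
  have : (0 : ℝ) ≤ m := m.cast_nonneg
  constructor <;> first | linarith | (right; ring)

lemma mul_gauss (h : IsBranch a b c d) (m : ℕ) :
    IsBranch b (a + b * (m + 1)) d (c + d * (m + 1)) := by
  obtain ⟨h1, h2, h3, h4, h5, h6, h7⟩ := h
  have hm : (0 : ℝ) ≤ m := m.cast_nonneg
  refine ⟨h2, by positivity, h4, by gcongr, by linarith, by nlinarith, ?_⟩
  rcases h7 with h7 | h7
  · right; linear_combination -h7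
  · left; linear_combination -h7

lemma sub_ne_zero (h : IsBranch a b c d) {z : ℂ} (hz : z ∈ cutPlane 0 1) : (a - c * z : ℂ) ≠ 0 := by
  have hc : 0 < c := by linarith [h.one_le]
  intro h0
  refine mem_cutPlane_iff.1 hz (a / c) (div_nonneg h.nonneg_left hc.le)
    ((div_le_one hc).2 h.left_le) ?_
  have : (c : ℂ) ≠ 0 := mod_cast hc.ne'
  push_cast
  field_simp
  linear_combination -h0

lemma mem_cutPlane (h : IsBranch a b c d) {z : ℂ} (hz : z ∈ cutPlane 0 1) :
    (d * z - b) / (a - c * z) ∈ cutPlane 0 1 := by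
  have hq := h.sub_ne_zero hz
  obtain ⟨h1, h2, h3, h4, h5, h6, h7⟩ := h
  rw [mem_cutPlane_iff]
  intro t ht0 ht1 ht
  rw [div_eq_iff hq] at ht
  have hp : 0 < c * t + d := by nlinarith
  refine mem_cutPlane_iff.1 hz ((a * t + b) / (c * t + d)) (by positivity) ?_ ?_
  · rw [div_le_one hp]; nlinarith
  · have : (c * t + d : ℂ) ≠ 0 := mod_cast hp.ne'
    push_cast
    rw [eq_div_iff this]
    linear_combination ht

lemma one_le_div (h : IsBranch a b c d) : 1 ≤ d / c := by
  rw [one_le_div₀ (by linarith [h.one_le])]; exact h.le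

lemma pole_mem_cutPlane (h : IsBranch a b c d) : (-(d / c : ℝ) : ℂ) ∈ cutPlane 0 1 := by
  refine mem_cutPlane_of_re_neg ?_
  have := h.one_le_div
  simp only [Complex.neg_re, Complex.ofReal_re]
  linarith

lemma norm_branchOp_aux (h : IsBranch a b c d) {φ : ℂ → ℂ} (hφ : φ ∈ O1 0 1) {M : ℝ}
    (hM : ∀ z ∈ cutPlane 0 1, ‖φ z‖ ≤ M) {z : ℂ} (hz : z ∈ cutPlane 0 1) :
    ‖branchOp a b c d φ z‖ * d ≤ 30 * M ∧
      ‖branchOp a b c d φ z‖ * (d ^ 2 * ‖(d * z - b : ℂ)‖) ≤ 30 * M := by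
  have hq := h.sub_ne_zero hz
  have hw := h.mem_cutPlane hz
  have hy := h.one_le_div
  have hM0 : 0 ≤ M := (norm_nonneg _).trans (hM z hz)
  have hc : 0 < c := by linarith [h.one_le]
  have hd : 0 < d := by linarith [h.le]
  have hcC : (c : ℂ) ≠ 0 := mod_cast hc.ne'
  have hdet : ‖(a * d - b * c : ℂ)‖ = 1 := by
    rcases h.det with h | h
    · have : (a * d - b * c : ℂ) = 1 := mod_cast h
      rw [this, norm_one]
    · have : (a * d - b * c : ℂ) = -1 := mod_cast h
      rw [this, norm_neg, norm_one]
  have hy0 : 0 < d / c := by positivity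
  set q : ℂ := a - c * z with hqdef
  set p : ℂ := d * z - b with hpdef
  set w : ℂ := p / q with hwdef
  have hq0 : 0 < ‖q‖ := norm_pos_iff.2 hq
  have hp0 := norm_nonneg p
  have hpq : c * ‖p‖ ≤ d * ‖q‖ + 1 := by
    have e : (c : ℂ) * p = -(d * q) + (a * d - b * c) := by rw [hpdef, hqdef]; ring
    have := congrArg norm e
    rw [norm_mul, Complex.norm_real, Real.norm_of_nonneg hc.le] at this
    rw [this]
    refine (norm_add_le _ _).trans ?_
    rw [hdet, norm_neg, norm_mul, Complex.norm_real, Real.norm_of_nonneg hd.le]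
  have hwy : w + (d / c : ℝ) = (a * d - b * c) / (c * q) := by
    rw [hwdef]
    push_cast
    field_simp
    rw [hpdef, hqdef]; ring
  have hwn : ‖w + (d / c : ℝ)‖ = 1 / (c * ‖q‖) := by
    rw [hwy, norm_div, hdet, norm_mul, Complex.norm_real, Real.norm_of_nonneg hc.le]
  have hdq : (a * d - b * c : ℂ) / c = q * (w + (d / c : ℝ)) := by
    rw [hwy]; field_simp
  set y := d / c with hydef
  have hB : branchOp a b c d φ z = q * (φ w - φ (-y) - (w + y) * deriv φ (-y)) := by
    rw [branchOp, hdq]; ring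
  rcases lt_or_ge 2 (d * ‖q‖) with hcase | hcase
  · have hlt : ‖w + y‖ < y / 2 := by
      rw [hwn, hydef, div_div, div_lt_div_iff₀ (by positivity) (by positivity)]
      nlinarith
    have hT := norm_taylor_le hφ hM hy hlt
    have hL : ‖branchOp a b c d φ z‖ ≤ 20 * M * c / (d ^ 3 * ‖q‖) := by
      rw [hB, norm_mul]
      calc _ ≤ ‖q‖ * (20 * M * ‖w + y‖ ^ 2 / y ^ 3) := by gcongr
        _ = _ := by rw [hwn, hydef]; field_simp
    have hL' : ‖branchOp a b c d φ z‖ * (d ^ 3 * ‖q‖) ≤ 20 * M * c := by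
      rwa [le_div_iff₀ (by positivity)] at hL
    set X := ‖branchOp a b c d φ z‖
    have hX : 0 ≤ X := norm_nonneg _
    have hcd := h.le
    constructor
    · have h1 : X * (d ^ 2 * 2) ≤ 20 * M * d := calc
        X * (d ^ 2 * 2) ≤ X * (d ^ 2 * (d * ‖q‖)) := by gcongr
        _ = X * (d ^ 3 * ‖q‖) := by ring
        _ ≤ 20 * M * c := hL'
        _ ≤ 20 * M * d := by gcongr
      have h2 : d * (X * d * 2) ≤ d * (20 * M) := by linarith
      have := le_of_mul_le_mul_left h2 hd
      linarith
    · have h1 : c * (X * (d ^ 2 * ‖p‖)) ≤ c * (30 * M) := calc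
        c * (X * (d ^ 2 * ‖p‖)) = X * (d ^ 2 * (c * ‖p‖)) := by ring
        _ ≤ X * (d ^ 2 * (3 / 2 * (d * ‖q‖))) := by gcongr X * (d ^ 2 * ?_); linarith
        _ = 3 / 2 * (X * (d ^ 3 * ‖q‖)) := by ring
        _ ≤ 3 / 2 * (20 * M * c) := by gcongr
        _ = _ := by ring
      exact le_of_mul_le_mul_left h1 hc
  · have hw1 := hM w hw
    have hw2 := norm_mul_norm_le hφ hM hw
    have hy1 := norm_mul_norm_le hφ hM h.pole_mem_cutPlane
    have hder := norm_deriv_le hφ hM hy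
    rw [norm_neg, Complex.norm_real, Real.norm_of_nonneg hy0.le, ← hydef] at hy1
    rw [hwdef, norm_div, ← hwdef] at hw2
    have hqd : ‖q‖ ≤ 2 / d := by rw [le_div_iff₀ hd]; linarith
    have hA1 : ‖φ (-y)‖ * d ≤ M * c := by
      rw [hydef, mul_div_assoc', div_le_iff₀ hc] at hy1
      exact hy1
    have hA2 : ‖q‖ * ‖φ (-y)‖ ≤ 2 * M * c / d ^ 2 := by
      rw [le_div_iff₀ (by positivity)]
      calc ‖q‖ * ‖φ (-y)‖ * d ^ 2 = (d * ‖q‖) * (‖φ (-y)‖ * d) := by ring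
        _ ≤ 2 * (M * c) := by gcongr
        _ = _ := by ring
    have hA3 : ‖q * (w + y) * deriv φ (-y)‖ ≤ 4 * M * c / d ^ 2 := by
      rw [← hdq, norm_mul, norm_div, hdet, Complex.norm_real, Real.norm_of_nonneg hc.le]
      calc 1 / c * ‖deriv φ (-y)‖ ≤ 1 / c * (4 * M / y ^ 2) := by gcongr
        _ = _ := by rw [hydef]; field_simp
    have hL : ‖branchOp a b c d φ z‖ ≤ ‖q‖ * ‖φ w‖ + 6 * M * c / d ^ 2 := by
      have e : branchOp a b c d φ z = q * φ w - q * φ (-y) - q * (w + y) * deriv φ (-y) := by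
        rw [hB]; ring
      rw [e]
      have := (norm_sub_le (q * φ w - q * φ (-y)) (q * (w + y) * deriv φ (-y))).trans
        (add_le_add_left (norm_sub_le (q * φ w) (q * φ (-y))) _)
      rw [norm_mul q, norm_mul q] at this
      have e2 : 6 * M * c / d ^ 2 = 2 * M * c / d ^ 2 + 4 * M * c / d ^ 2 := by ring
      linarith
    constructor
    · calc ‖branchOp a b c d φ z‖ * d ≤ (‖q‖ * ‖φ w‖ + 6 * M * c / d ^ 2) * d := by gcongr
        _ = (d * ‖q‖) * ‖φ w‖ + 6 * M * (c / d) := by field_simp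
        _ ≤ 2 * M + 6 * M * 1 := by
            gcongr
            exact (div_le_one hd).2 h.le
        _ ≤ 30 * M := by linarith
    · have hw3 : ‖φ w‖ * ‖p‖ ≤ M * ‖q‖ := by
        rwa [mul_div_assoc', div_le_iff₀ hq0] at hw2
      calc ‖branchOp a b c d φ z‖ * (d ^ 2 * ‖p‖)
          ≤ (‖q‖ * ‖φ w‖ + 6 * M * c / d ^ 2) * (d ^ 2 * ‖p‖) := by gcongr
        _ = d ^ 2 * ‖q‖ * (‖φ w‖ * ‖p‖) + 6 * M * (c * ‖p‖) := by field_simp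
        _ ≤ d ^ 2 * ‖q‖ * (M * ‖q‖) + 6 * M * 3 := by gcongr; linarith
        _ = M * (d * ‖q‖) ^ 2 + 18 * M := by ring
        _ ≤ M * 2 ^ 2 + 18 * M := by gcongr
        _ ≤ 30 * M := by linarith

/-- The branch operator is controlled by the increment of the potential over `g([0,1])`. -/
lemma norm_branchOp_le (h : IsBranch a b c d) {φ : ℂ → ℂ} (hφ : φ ∈ O1 0 1) {M : ℝ}
    (hM : ∀ z ∈ cutPlane 0 1, ‖φ z‖ ≤ M) {z : ℂ} (hz : z ∈ cutPlane 0 1) {s x : ℝ}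
    (hs : 1 ≤ s * d) (hx : ∀ t : ℝ, 0 ≤ t → t ≤ 1 → |t - x| ≤ ‖z - t‖) :
    ‖branchOp a b c d φ z‖ ≤
      720 * M * |potential s ((a + b) / (c + d) - x) - potential s (b / d - x)| := by
  obtain ⟨hb1, hb2⟩ := h.norm_branchOp_aux hφ hM hz
  have hM0 : 0 ≤ M := (norm_nonneg _).trans (hM z hz)
  have hc : 0 < c := by linarith [h.one_le]
  have hd : 0 < d := by linarith [h.le]
  have hcd := h.le
  set X := ‖branchOp a b c d φ z‖
  have hX : 0 ≤ X := norm_nonneg _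
  set u := |b / d - x| with hu
  have hu0 : 0 ≤ u := abs_nonneg _
  have hup : d * u ≤ ‖(d * z - b : ℂ)‖ := by
    have h1 := hx (b / d) (div_nonneg h.nonneg_right hd.le) ((div_le_one hd).2 h.right_le)
    have e : (d * z - b : ℂ) = d * (z - (b / d : ℝ)) := by
      have : (d : ℂ) ≠ 0 := mod_cast hd.ne'
      push_cast; field_simp
    rw [e, norm_mul, Complex.norm_real, Real.norm_of_nonneg hd.le]
    gcongr
  have hlen : |(a + b) / (c + d) - b / d| = 1 / (d * (c + d)) := by
    have e : (a + b) / (c + d) - b / d = (a * d - b * c) / (d * (c + d)) := by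
      field_simp; ring
    rw [e, abs_div, abs_of_pos (show 0 < d * (c + d) by positivity)]
    rcases h.det with h | h <;> rw [h] <;> simp
  have hlen1 : 1 / (d * (c + d)) ≤ 1 / d ^ 2 :=
    one_div_le_one_div_of_le (by positivity) (by nlinarith)
  have hlen2 : 1 / (2 * d ^ 2) ≤ 1 / (d * (c + d)) :=
    one_div_le_one_div_of_le (by positivity) (by nlinarith)
  set V := u + 1 / d ^ 2 with hV
  have hV0 : 0 < V := by positivity
  have hv0 : |b / d - x| ≤ V := by rw [hV, ← hu]; linarith [show 0 < 1 / d ^ 2 by positivity]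
  have hv1 : |(a + b) / (c + d) - x| ≤ V := by
    have : (a + b) / (c + d) - x = (b / d - x) + ((a + b) / (c + d) - b / d) := by ring
    rw [this]
    refine (abs_add_le _ _).trans ?_
    rw [hlen, hV]
    linarith
  have hσs : 1 / d ≤ s := by rwa [div_le_iff₀ hd]
  have key : 1 / d * |(a + b) / (c + d) - b / d| / (V + (1 / d) ^ 2) ≤
      3 * |potential s ((a + b) / (c + d) - x) - potential s (b / d - x)| := by
    rcases le_total (b / d) ((a + b) / (c + d)) with hle | hle
    · have := potential_sub_ge (s := s) (σ := 1 / d) (by positivity) hσs (sub_le_sub_right hle x) hv0 hv1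
      rw [abs_of_nonneg (sub_nonneg.2 hle)]
      rw [sub_sub_sub_cancel_right] at this
      exact this.trans (by gcongr; exact le_abs_self _)
    · have := potential_sub_ge (s := s) (σ := 1 / d) (by positivity) hσs (sub_le_sub_right hle x) hv1 hv0
      rw [abs_sub_comm, abs_of_nonneg (sub_nonneg.2 hle), abs_sub_comm]
      rw [sub_sub_sub_cancel_right] at this
      exact this.trans (by gcongr; exact le_abs_self _)
  rw [hlen] at key
  set Δ := |potential s ((a + b) / (c + d) - x) - potential s (b / d - x)|
  have key2 : 1 / (2 * d * (d ^ 2 * u + 2)) ≤ 3 * Δ := by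
    refine le_trans ?_ key
    calc 1 / (2 * d * (d ^ 2 * u + 2)) = 1 / d * (1 / (2 * d ^ 2)) / (V + (1 / d) ^ 2) := by
          rw [hV]; field_simp; ring
      _ ≤ _ := by gcongr
  have h1 : X * (d ^ 2 * (d * u)) ≤ 30 * M := le_trans (by gcongr) hb2
  have h2 : X * (2 * d * (d ^ 2 * u + 2)) ≤ 240 * M := by nlinarith
  calc X = X * (2 * d * (d ^ 2 * u + 2)) * (1 / (2 * d * (d ^ 2 * u + 2))) := by
        field_simp
    _ ≤ 240 * M * (3 * Δ) := by gcongr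
    _ = _ := by ring

end IsBranch

lemma Tterm_eq_branchOp (φ : ℂ → ℂ) (m : ℕ) {z : ℂ} (hz : z ∈ cutPlane 0 1) :
    Tterm φ m z = branchOp 0 1 1 (m + 1) φ z := by
  have hz0 := ne_zero_of_mem_cutPlane hz
  have e : (((m + 1 : ℝ) : ℂ) * z - (1 : ℝ)) / ((0 : ℝ) - (1 : ℝ) * z) = z⁻¹ - ((m : ℂ) + 1) := by
    push_cast
    have : (0 - 1 * z : ℂ) ≠ 0 := by simpa using hz0
    field_simp
    ring
  rw [Tterm, branchOp, e]
  push_cast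
  simp

lemma gauss_mem_cutPlane {z : ℂ} (hz : z ∈ cutPlane 0 1) (m : ℕ) :
    z⁻¹ - ((m : ℂ) + 1) ∈ cutPlane 0 1 := by
  have h := (IsBranch.gauss m).mem_cutPlane hz
  have hz0 := ne_zero_of_mem_cutPlane hz
  convert h using 1
  push_cast
  have : (0 - 1 * z : ℂ) ≠ 0 := by simpa using hz0
  field_simp
  ring

lemma hasDerivAt_Tterm {φ : ℂ → ℂ} (hφ : φ ∈ O1 0 1) (m : ℕ) {z : ℂ} (hz : z ∈ cutPlane 0 1) :
    HasDerivAt (Tterm φ m)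
      (-(φ (z⁻¹ - ((m : ℂ) + 1)) - φ (-((m : ℂ) + 1))) + z⁻¹ * deriv φ (z⁻¹ - ((m : ℂ) + 1))) z := by
  have hz0 := ne_zero_of_mem_cutPlane hz
  have hw := gauss_mem_cutPlane hz m
  have hd : HasDerivAt φ (deriv φ (z⁻¹ - ((m : ℂ) + 1))) (z⁻¹ - ((m : ℂ) + 1)) :=
    ((hφ.1 _ hw).differentiableAt (isOpen_cutPlane.mem_nhds hw)).hasDerivAt
  have hi : HasDerivAt (fun z : ℂ => z⁻¹ - ((m : ℂ) + 1)) (-(z ^ 2)⁻¹) z :=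
    (hasDerivAt_inv hz0).sub_const _
  have h := (((hasDerivAt_id z).neg).mul ((hd.comp z hi).sub_const (φ (-((m : ℂ) + 1))))).add_const
    (deriv φ (-((m : ℂ) + 1)))
  convert! h using 1
  simp only [Pi.neg_apply, id, Function.comp]
  field_simp

lemma branchOp_Tterm {a b c d : ℝ} (h : IsBranch a b c d) {φ : ℂ → ℂ} (hφ : φ ∈ O1 0 1) (m : ℕ)
    {z : ℂ} (hz : z ∈ cutPlane 0 1) :
    branchOp a b c d (Tterm φ m) z = branchOp b (a + b * (m + 1)) d (c + d * (m + 1)) φ z := by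
  have hc : (c : ℂ) ≠ 0 := mod_cast (by linarith [h.one_le] : c ≠ 0)
  have hd : (d : ℂ) ≠ 0 := mod_cast (by linarith [h.one_le, h.le] : d ≠ 0)
  have hq := h.sub_ne_zero hz
  have hp : (d * z - b : ℂ) ≠ 0 := by
    have := (h.mul_gauss m).sub_ne_zero hz
    contrapose! this
    linear_combination -this
  have hp' : (b - d * z : ℂ) ≠ 0 := by contrapose! hp; linear_combination -hp
  have e1 : ((d * z - b : ℂ) / (a - c * z))⁻¹ - ((m : ℂ) + 1) =
      ((c + d * (m + 1) : ℝ) * z - (a + b * (m + 1) : ℝ)) / (b - d * z) := by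
    push_cast
    rw [inv_div, ← neg_sub (b : ℂ) (d * z), div_neg, eq_div_iff hp', sub_mul, neg_mul,
      div_mul_cancel₀ _ hp']
    ring
  have e2 : (-(d / c : ℝ) : ℂ)⁻¹ - ((m : ℂ) + 1) = (-((c + d * (m + 1)) / d : ℝ) : ℂ) := by
    push_cast
    field_simp
    ring
  rw [branchOp, (hasDerivAt_Tterm hφ m h.pole_mem_cutPlane).deriv, Tterm, Tterm, e1, e2, branchOp]
  push_cast
  field_simp
  ring

end Branches

section Iterates

lemma exists_ball_subset_cutPlane {z : ℂ} (hz : z ∈ cutPlane 0 1) :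
    ∃ δ > 0, ∀ w ∈ Metric.ball z δ, w ∈ cutPlane 0 1 ∧
      ∀ t : ℝ, 0 ≤ t → t ≤ 1 → δ ≤ ‖w - t‖ := by
  obtain ⟨ε, hε, hball⟩ := Metric.isOpen_iff.1 isOpen_cutPlane z hz
  refine ⟨ε / 2, by positivity, fun w hw => ⟨hball ?_, fun t ht0 ht1 => ?_⟩⟩
  · exact Metric.ball_subset_ball (by linarith) hw
  · by_contra! hc
    have h1 : (t : ℂ) ∈ Metric.ball z ε := by
      rw [Metric.mem_ball] at hw ⊢
      rw [← dist_eq_norm, dist_comm] at hc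
      linarith [dist_triangle (t : ℂ) w z]
    exact mem_cutPlane_iff.1 (hball h1) t ht0 ht1 rfl

lemma exists_abs_sub_le_norm (z : ℂ) :
    ∃ x : ℝ, 0 ≤ x ∧ x ≤ 1 ∧ ∀ t : ℝ, 0 ≤ t → t ≤ 1 → |t - x| ≤ ‖z - t‖ := by
  have hre : ∀ t : ℝ, |z.re - t| ≤ ‖z - t‖ := fun t => by
    simpa using Complex.abs_re_le_norm (z - t)
  rcases le_total z.re 0 with h | h
  · refine ⟨0, le_rfl, zero_le_one, fun t h0 h1 => le_trans ?_ (hre t)⟩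
    rw [abs_of_nonneg (by linarith), abs_of_nonpos (by linarith)]
    linarith
  · rcases le_total z.re 1 with h' | h'
    · exact ⟨z.re, h, h', fun t _ _ => by rw [abs_sub_comm]; exact hre t⟩
    · refine ⟨1, zero_le_one, le_rfl, fun t h0 h1 => le_trans ?_ (hre t)⟩
      rw [abs_of_nonpos (by linarith), abs_of_nonneg (by linarith)]
      linarith

lemma summable_inv_succ_sq : Summable fun m : ℕ => 1 / ((m : ℝ) + 1) ^ 2 := by
  have := (summable_nat_add_iff 1).2 (Real.summable_one_div_nat_pow.2 one_lt_two)
  simpa using this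

lemma norm_le_of_hasSum {f : ℕ → ℂ} {S : ℂ} {g : ℕ → ℝ} {B : ℝ} (hf : HasSum f S)
    (hfg : ∀ m, ‖f m‖ ≤ g m) (hg : ∀ N, ∑ m ∈ Finset.range N, g m ≤ B) : ‖S‖ ≤ B :=
  le_of_tendsto hf.tendsto_sum_nat.norm <| Eventually.of_forall fun N =>
    (norm_sum_le_of_le _ fun m _ => hfg m).trans (hg N)

variable {φ : ℂ → ℂ} {M : ℝ}

lemma norm_Tterm_le (hφ : φ ∈ O1 0 1) (hM : ∀ z ∈ cutPlane 0 1, ‖φ z‖ ≤ M) (m : ℕ) {z : ℂ}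
    (hz : z ∈ cutPlane 0 1) {δ : ℝ} (hδ : 0 < δ)
    (hzδ : ∀ t : ℝ, 0 ≤ t → t ≤ 1 → δ ≤ ‖z - t‖) :
    ‖Tterm φ m z‖ ≤ 30 * M / δ * (1 / ((m : ℝ) + 1) ^ 2) := by
  rw [Tterm_eq_branchOp φ m hz]
  have h := ((IsBranch.gauss m).norm_branchOp_aux hφ hM hz).2
  have hn : (1 : ℝ) ≤ m + 1 := by linarith [(m.cast_nonneg : (0 : ℝ) ≤ m)]
  have hn0 : (0 : ℝ) < m + 1 := by positivity
  have h1 : δ ≤ ‖((m + 1 : ℝ) : ℂ) * z - (1 : ℝ)‖ := by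
    have e : ((m + 1 : ℝ) : ℂ) * z - (1 : ℝ) = (m + 1 : ℝ) * (z - (1 / (m + 1) : ℝ)) := by
      have : ((m + 1 : ℝ) : ℂ) ≠ 0 := mod_cast hn0.ne'
      push_cast at this ⊢
      field_simp
    rw [e, norm_mul, Complex.norm_real, Real.norm_of_nonneg hn0.le]
    have := hzδ (1 / (m + 1)) (by positivity) ((div_le_one hn0).2 hn)
    nlinarith
  have h2 : ‖branchOp 0 1 1 (m + 1) φ z‖ * ((m + 1) ^ 2 * δ) ≤ 30 * M := le_trans (by gcongr) h
  rw [div_mul_div_comm, mul_one, le_div_iff₀ (by positivity)]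
  linarith

lemma differentiableOn_Tterm (hφ : φ ∈ O1 0 1) (m : ℕ) :
    DifferentiableOn ℂ (Tterm φ m) (cutPlane 0 1) := fun _ hz =>
  (hasDerivAt_Tterm hφ m hz).differentiableAt.differentiableWithinAt

lemma hasSum_Tterm (hφ : φ ∈ O1 0 1) (hM : ∀ z ∈ cutPlane 0 1, ‖φ z‖ ≤ M) {z : ℂ}
    (hz : z ∈ cutPlane 0 1) :
    HasSum (fun m => Tterm φ m z) (Tbrj φ z) ∧
      HasSum (fun m => deriv (Tterm φ m) z) (deriv (Tbrj φ) z) ∧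
      DifferentiableAt ℂ (Tbrj φ) z := by
  obtain ⟨δ, hδ, hball⟩ := exists_ball_subset_cutPlane hz
  have hsum := summable_inv_succ_sq.mul_left (30 * M / δ)
  have hbd : ∀ (m : ℕ) (w : ℂ), w ∈ Metric.ball z δ →
      ‖Tterm φ m w‖ ≤ 30 * M / δ * (1 / ((m : ℝ) + 1) ^ 2) := fun m w hw =>
    norm_Tterm_le hφ hM m (hball w hw).1 hδ (hball w hw).2
  have hdiff : ∀ m, DifferentiableOn ℂ (Tterm φ m) (Metric.ball z δ) := fun m =>
    (differentiableOn_Tterm hφ m).mono fun w hw => (hball w hw).1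
  have hzb := Metric.mem_ball_self (x := z) hδ
  refine ⟨(hsum.of_norm_bounded fun m => hbd m z hzb).hasSum,
    Complex.hasSum_deriv_of_summable_norm hsum hdiff Metric.isOpen_ball hbd hzb, ?_⟩
  exact (Complex.differentiableOn_tsum_of_summable_norm hsum hdiff Metric.isOpen_ball hbd).differentiableAt
    (Metric.ball_mem_nhds z hδ)

lemma IsBranch.hasSum_branchOp {a b c d : ℝ} (h : IsBranch a b c d) (hφ : φ ∈ O1 0 1)
    (hM : ∀ z ∈ cutPlane 0 1, ‖φ z‖ ≤ M) {z : ℂ} (hz : z ∈ cutPlane 0 1) :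
    HasSum (fun m : ℕ => branchOp b (a + b * (m + 1)) d (c + d * (m + 1)) φ z)
      (branchOp a b c d (Tbrj φ) z) := by
  simp only [← branchOp_Tterm h hφ _ hz]
  have hy := hasSum_Tterm hφ hM h.pole_mem_cutPlane
  exact (((hasSum_Tterm hφ hM (h.mem_cutPlane hz)).1.sub hy.1).mul_left _).sub (hy.2.1.mul_left _)

/-- A bound for `L_g ψ` by increments of the potential gives a bound for `Tψ`. -/
lemma norm_Tbrj_le (hφ : φ ∈ O1 0 1) (hM : ∀ z ∈ cutPlane 0 1, ‖φ z‖ ≤ M) {z : ℂ}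
    (hz : z ∈ cutPlane 0 1) {s x K : ℝ} (hs : 0 < s) (hx0 : 0 ≤ x) (hx1 : x ≤ 1) (hK : 0 ≤ K)
    (hb : ∀ m : ℕ, ‖branchOp 0 1 1 (m + 1) φ z‖ ≤
      K * |potential s ((0 + 1) / (1 + (m + 1)) - x) - potential s (1 / (m + 1) - x)|) :
    ‖Tbrj φ z‖ ≤ K * (2 * (s * Real.log (1 + 1 / s))) := by
  refine norm_le_of_hasSum (hasSum_Tterm hφ hM hz).1
    (fun m => (Tterm_eq_branchOp φ m hz ▸ hb m :)) fun N => ?_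
  rw [← Finset.mul_sum]
  gcongr
  have hmono := monotone_potential_sub hs x
  have h := sum_abs_sub_le hmono (a := 1) (b := 0) (c := 0)
    (d := 1) le_rfl one_pos N
  simp only [zero_mul, add_zero, zero_add, one_mul, div_one] at h ⊢
  refine h.trans ?_
  have h1 : potential s (0 - x) ≤ potential s (1 - x) := hmono zero_le_one
  rw [abs_of_nonneg (sub_nonneg.2 h1), zero_sub, potential_neg]
  linarith [potential_le hs (show 1 - x ≤ 1 by linarith), potential_le hs hx1]

lemma Tbrj_mem_O1 (hφ : φ ∈ O1 0 1) (hM : ∀ z ∈ cutPlane 0 1, ‖φ z‖ ≤ M) :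
    Tbrj φ ∈ O1 0 1 ∧ ∃ M', ∀ z ∈ cutPlane 0 1, ‖Tbrj φ z‖ ≤ M' := by
  refine ⟨⟨fun z hz => (hasSum_Tterm hφ hM hz).2.2.differentiableWithinAt, ?_⟩, ?_⟩
  · set A := ∑' m : ℕ, 1 / ((m : ℝ) + 1) ^ 2
    have hlim : Tendsto (fun z : ℂ => 60 * M * A * ‖z⁻¹‖) (Bornology.cobounded ℂ) (𝓝 0) := by
      simpa using (tendsto_inv₀_cobounded (α := ℂ)).norm.const_mul (60 * M * A)
    refine squeeze_zero_norm' ?_ hlim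
    have hev : ∀ᶠ z : ℂ in Bornology.cobounded ℂ, 2 ≤ ‖z‖ :=
      tendsto_norm_cobounded_atTop.eventually_ge_atTop 2
    filter_upwards [hev] with z hz2
    have hz : z ∈ cutPlane 0 1 := mem_cutPlane_of_one_lt_norm (by linarith)
    have hb : ∀ m, ‖Tterm φ m z‖ ≤ 30 * M / (‖z‖ / 2) * (1 / ((m : ℝ) + 1) ^ 2) := fun m =>
      norm_Tterm_le hφ hM m hz (by linarith) fun t h0 h1 => by
        have := norm_sub_norm_le z t
        rw [Complex.norm_real, Real.norm_of_nonneg h0] at this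
        linarith
    have := tsum_of_norm_bounded (summable_inv_succ_sq.hasSum.mul_left _) hb
    refine this.trans_eq ?_
    rw [norm_inv]
    field_simp
    ring
  · refine ⟨720 * M * (2 * (1 * Real.log (1 + 1 / 1))), fun z hz => ?_⟩
    obtain ⟨x, hx0, hx1, hx⟩ := exists_abs_sub_le_norm z
    have hM0 : 0 ≤ M := (norm_nonneg _).trans (hM z hz)
    refine norm_Tbrj_le hφ hM hz one_pos hx0 hx1 (by positivity) fun m => ?_
    exact (IsBranch.gauss m).norm_branchOp_le hφ hM hz (by simp) hx

lemma iterate_Tbrj_mem_O1 (hφ : φ ∈ O1 0 1) (hM : ∀ z ∈ cutPlane 0 1, ‖φ z‖ ≤ M) (k : ℕ) :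
    Tbrj^[k] φ ∈ O1 0 1 ∧ ∃ M', ∀ z ∈ cutPlane 0 1, ‖(Tbrj^[k] φ) z‖ ≤ M' := by
  induction k with
  | zero => exact ⟨hφ, M, hM⟩
  | succ k ih =>
    obtain ⟨h1, M', h2⟩ := ih
    rw [Function.iterate_succ_apply']
    exact Tbrj_mem_O1 h1 h2

/-- `l` is the inverse golden ratio; the hypotheses on `c, d` force every denominator obtained
after `k` further Gauss steps to be at least `1 / s`. -/
lemma IsBranch.norm_branchOp_iterate_le (hφ : φ ∈ O1 0 1) (hM : ∀ z ∈ cutPlane 0 1, ‖φ z‖ ≤ M)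
    {z : ℂ} (hz : z ∈ cutPlane 0 1) {s x l : ℝ} (hs : 0 < s) (hl : l ^ 2 + l = 1)
    (hx : ∀ t : ℝ, 0 ≤ t → t ≤ 1 → |t - x| ≤ ‖z - t‖) (k : ℕ) :
    ∀ {a b c d : ℝ}, IsBranch a b c d → l ^ k ≤ s * d → l ^ (k + 1) ≤ s * c →
      ‖branchOp a b c d (Tbrj^[k] φ) z‖ ≤
        720 * M * |potential s ((a + b) / (c + d) - x) - potential s (b / d - x)| := by
  have hM0 : 0 ≤ M := (norm_nonneg _).trans (hM z hz)
  induction k with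
  | zero => exact fun h hd _ => h.norm_branchOp_le hφ hM hz (by simpa using hd) hx
  | succ k ih =>
    intro a b c d h hd hc
    have hd0 : 0 < d := by linarith [h.one_le, h.le]
    have hc0 : 0 ≤ c := by linarith [h.one_le]
    obtain ⟨hk, M', hM'⟩ := iterate_Tbrj_mem_O1 hφ hM k
    rw [Function.iterate_succ_apply']
    refine norm_le_of_hasSum (h.hasSum_branchOp hk hM' hz)
      (fun m => ih (h.mul_gauss m) ?_ hd) fun N => ?_
    · have e : l ^ k = l ^ (k + 1 + 1) + l ^ (k + 1) := by linear_combination (-l ^ k) * hl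
      have hm : 0 ≤ s * d * m := by positivity
      nlinarith
    · rw [← Finset.mul_sum]
      gcongr
      exact sum_abs_sub_le (monotone_potential_sub hs x) hc0 hd0 N

end Iterates

/-- the iterates of `T` on bounded functions of `𝒪¹(ℂ̄∖[0,1])` satisfy a
`(√5 − 1)/2` spectral-radius estimate in the sup norm (Proposition 4.5). -/
theorem T_spectral_estimate_Hinfty :
    ∃ C > 0, ∀ φ ∈ O1 0 1, ∀ (k : ℕ), ∀ M : ℝ,
      (∀ z ∈ cutPlane 0 1, ‖φ z‖ ≤ M) →
        ∀ z ∈ cutPlane 0 1,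
          ‖(Tbrj^[k] φ) z‖ ≤ C * (1 + k) * ((Real.sqrt 5 - 1) / 2) ^ k * M := by
  refine ⟨2880, by norm_num, fun φ hφ k M hM z hz => ?_⟩
  have hM0 : 0 ≤ M := (norm_nonneg _).trans (hM z hz)
  set l : ℝ := (Real.sqrt 5 - 1) / 2 with hldef
  have h5 : Real.sqrt 5 ^ 2 = 5 := Real.sq_sqrt (by norm_num)
  have h52 : 2 ≤ Real.sqrt 5 := Real.le_sqrt_of_sq_le (by norm_num)
  have hl : l ^ 2 + l = 1 := by rw [hldef]; linear_combination h5 / 4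
  have hl2 : 1 / 2 ≤ l := by rw [hldef]; linarith
  have hl0 : 0 < l := by linarith
  have hl1 : l ≤ 1 := by nlinarith
  cases k with
  | zero =>
    have := hM z hz
    simp
    linarith
  | succ k =>
    obtain ⟨x, hx0, hx1, hx⟩ := exists_abs_sub_le_norm z
    obtain ⟨hk, M', hM'⟩ := iterate_Tbrj_mem_O1 hφ hM k
    have hlk : 0 < l ^ k := by positivity
    rw [Function.iterate_succ_apply']
    have hT := norm_Tbrj_le hk hM' hz hlk hx0 hx1 (K := 720 * M) (by positivity) fun m =>
      IsBranch.norm_branchOp_iterate_le hφ hM hz hlk hl hx k (IsBranch.gauss m)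
        (le_mul_of_one_le_right hlk.le (by linarith [(m.cast_nonneg : (0 : ℝ) ≤ m)]))
        (by rw [mul_one]; exact pow_le_pow_of_le_one hl0.le hl1 k.le_succ)
    have hlog : Real.log (1 + 1 / l ^ k) ≤ k + 1 := by
      have h1 : 1 / l ^ k ≤ 2 ^ k := by
        rw [div_le_iff₀ hlk, ← mul_pow]
        exact one_le_pow₀ (by linarith)
      have h2 : 1 + 1 / l ^ k ≤ 2 ^ (k + 1) := by
        have : (1 : ℝ) ≤ 2 ^ k := one_le_pow₀ one_le_two
        rw [pow_succ]
        linarith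
      have h3 : Real.log (1 + 1 / l ^ k) ≤ Real.log (2 ^ (k + 1)) := by gcongr
      rw [Real.log_pow] at h3
      push_cast at h3
      have h4 : Real.log 2 ≤ 1 := by linarith [Real.log_two_lt_d9]
      nlinarith [(k.cast_nonneg : (0 : ℝ) ≤ k)]
    calc ‖Tbrj (Tbrj^[k] φ) z‖ ≤ 720 * M * (2 * (l ^ k * Real.log (1 + 1 / l ^ k))) := hT
      _ ≤ 720 * M * (2 * (l ^ k * (k + 1))) := by gcongr
      _ ≤ 720 * M * (2 * (2 * l * l ^ k * (1 + (k + 1 : ℕ)))) := by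
          push_cast
          gcongr 720 * M * (2 * ?_)
          have : l ^ k ≤ 2 * l * l ^ k := by nlinarith
          exact mul_le_mul this (by linarith) (by positivity) (by positivity)
      _ = 2880 * (1 + (k + 1 : ℕ)) * l ^ (k + 1) * M := by rw [pow_succ]; ring
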